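/- Let (k,ℓ,d) be matroidal sparsity parameters and let G be a (k,ℓ)-sparse d-uniform hypergraph with m hyperedges. Then there exists a nonzero real polynomial P in the d·k·m entry variables a^j_{e_i} such that for every point v ∈ ℝ^{dkm} with P(v) ≠ 0, the realization of M_{k,0,d}(G) at v (the real matrix obtained by substituting the coordinates of v for the corresponding indeterminates) has rank m; consequently, the set of v for which the realization has rank m is an open dense subset of ℝ^{dkm} whose complement is contained in a proper algebraic subset. -/

import Mathlib

/-- Index type for the generic entry variables `a^j_{e_i}` of the natural matrix:
one for each hyperedge `e`, each endpoint of `e`, and each `j ∈ Fin k`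
(there are `d*k*m` of them for a `d`-uniform hypergraph with `m` edges). -/
def GenVars (n k : ℕ) {ι : Type} (ends : ι → Finset (Fin n)) : Type :=
  Σ e : ι, {v : Fin n // v ∈ ends e} × Fin k

/-- The realization of the generic natural matrix `M_{k,0,d}(G)` at the point `v`:
the real matrix obtained by substituting the coordinates of `v` for the corresponding
indeterminates. -/
def realization (n k : ℕ) {ι : Type} (ends : ι → Finset (Fin n))
    (v : GenVars n k ends → ℝ) : Matrix ι (Fin n × Fin k) ℝ :=
  Matrix.of fun e p =>
    if h : p.1 ∈ ends e then v (⟨e, ⟨p.1, h⟩, p.2⟩ : GenVars n k ends) else 0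

/-- Over an ordered field, a matrix has full row rank iff the Gram matrix of its
rows is nonsingular. -/
theorem Matrix.rank_eq_card_iff_det_mul_transpose_ne_zero {m n R : Type*} [Fintype m]
    [DecidableEq m] [Fintype n] [Field R] [LinearOrder R] [IsStrictOrderedRing R]
    (A : Matrix m n R) : A.rank = Fintype.card m ↔ (A * A.transpose).det ≠ 0 := by
  rw [← A.rank_self_mul_transpose]
  refine ⟨fun h => ?_, Matrix.rank_of_det_ne_zero⟩
  rw [← isUnit_iff_ne_zero, ← Matrix.isUnit_iff_isUnit_det,
    ← Matrix.linearIndependent_rows_iff_isUnit, linearIndependent_iff_card_eq_finrank_span,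
    Set.finrank, ← Matrix.rank_eq_finrank_span_row, h]

/-- The nonvanishing locus of a nonzero polynomial is dense. -/
theorem MvPolynomial.dense_setOf_eval_ne_zero {σ 𝕜 : Type*} [NontriviallyNormedField 𝕜]
    {P : MvPolynomial σ 𝕜} (hP : P ≠ 0) : Dense {v : σ → 𝕜 | MvPolynomial.eval v P ≠ 0} := by
  classical
  rw [dense_iff_inter_open]
  rintro U hU ⟨x, hx⟩
  obtain ⟨I, u, hu, hsub⟩ := isOpen_pi_iff.mp hU x hx
  by_contra hempty
  refine hP (MvPolynomial.funext_set (fun i => if i ∈ I then u i else Set.univ) ?_ ?_)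
  · intro i
    by_cases hi : i ∈ I
    · simpa [hi] using infinite_of_mem_nhds (x i) ((hu i hi).1.mem_nhds (hu i hi).2)
    · simpa [hi] using Set.infinite_univ
  · intro v hv
    rw [map_zero]
    by_contra hne
    refine hempty ⟨v, hsub fun i hi => ?_, hne⟩
    simpa [Finset.mem_coe.mp hi] using hv i (Set.mem_univ i)

/-- The natural matrix with polynomial entries, the variables being its generic entries. -/
noncomputable def genericNaturalMatrix (n k : ℕ) {ι : Type} (ends : ι → Finset (Fin n)) :
    Matrix ι (Fin n × Fin k) (MvPolynomial (GenVars n k ends) ℝ) :=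
  Matrix.of fun e p =>
    if h : p.1 ∈ ends e then
      MvPolynomial.X (⟨e, ⟨p.1, h⟩, p.2⟩ : GenVars n k ends) else 0

theorem genericNaturalMatrix_map_eval (n k : ℕ) {ι : Type} (ends : ι → Finset (Fin n))
    (v : GenVars n k ends → ℝ) :
    (genericNaturalMatrix n k ends).map (MvPolynomial.eval v) = realization n k ends v := by
  ext e p
  by_cases h : p.1 ∈ ends e
  · simp only [genericNaturalMatrix, realization, Matrix.map_apply, Matrix.of_apply, dif_pos h]
    exact MvPolynomial.eval_X (f := v) _
  · simp [genericNaturalMatrix, realization, h]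

theorem continuous_realization (n k : ℕ) {ι : Type} (ends : ι → Finset (Fin n)) :
    Continuous (realization n k ends) := by
  refine continuous_matrix fun e p => ?_
  by_cases h : p.1 ∈ ends e
  · simpa [realization, h] using continuous_apply _
  · simpa [realization, h] using continuous_const

/-- If every vertex set `V'` induces at most `k * |V'|` hyperedges, then distinct hyperedges
can be assigned distinct columns of the natural matrix, each at one of its endpoints. -/
theorem exists_injective_endpoint_column (n k : ℕ) {ι : Type} [Fintype ι]
    (ends : ι → Finset (Fin n))
    (h : ∀ V' : Finset (Fin n),
      (Finset.univ.filter fun e => ends e ⊆ V').card ≤ k * V'.card) :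
    ∃ f : ι → Fin n × Fin k, Function.Injective f ∧ ∀ e, (f e).1 ∈ ends e := by
  classical
  obtain ⟨f, hf, hmem⟩ := (Finset.all_card_le_biUnion_card_iff_exists_injective
    fun e => ends e ×ˢ (Finset.univ : Finset (Fin k))).mp fun s => by
      have hunion : (s.biUnion fun e => ends e ×ˢ (Finset.univ : Finset (Fin k))) =
          s.biUnion ends ×ˢ Finset.univ := by
        ext p
        simp
      rw [hunion, Finset.card_product, Finset.card_univ, Fintype.card_fin, mul_comm]
      refine (Finset.card_le_card fun e he => ?_).trans (h (s.biUnion ends))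
      simpa using Finset.subset_biUnion_of_mem ends he
  exact ⟨f, hf, fun e => (Finset.mem_product.mp (hmem e)).1⟩

/-- The minor on an injective choice of endpoint columns is a nonzero polynomial. -/
theorem det_genericNaturalMatrix_submatrix_ne_zero (n k : ℕ) {ι : Type} [Fintype ι]
    [DecidableEq ι] (ends : ι → Finset (Fin n)) {f : ι → Fin n × Fin k}
    (hf : Function.Injective f) (hmem : ∀ e, (f e).1 ∈ ends e) :
    ((genericNaturalMatrix n k ends).submatrix id f).det ≠ 0 := by
  intro h
  have hone : (realization n k ends fun x => if (x.2.1.1, x.2.2) = f x.1 then 1 else 0).submatrix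
      id f = 1 := by
    ext e e'
    by_cases hee : e = e'
    · subst hee
      simp [realization, hmem]
    · simp [realization, Matrix.one_apply_ne hee, hf.eq_iff, Ne.symm hee]
  have := congrArg (MvPolynomial.eval
    fun x : GenVars n k ends => if (x.2.1.1, x.2.2) = f x.1 then (1 : ℝ) else 0) h
  rw [RingHom.map_det, RingHom.mapMatrix_apply, ← Matrix.submatrix_map,
    genericNaturalMatrix_map_eval, hone, Matrix.det_one, map_zero] at this
  exact one_ne_zero this

/-- Let `(k, ℓ, d)` be matroidal sparsity parameters and let `G` be a
`(k, ℓ)`-sparse `d`-uniform hypergraph with `m` hyperedges.  Then there exists a nonzero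
real polynomial `P` in the `d*k*m` entry variables `a^j_{e_i}` such that every point `v`
with `P v ≠ 0` yields a realization of `M_{k,0,d}(G)` of rank `m`; consequently the set
of such `v` is an open dense subset of `ℝ^{dkm}`. -/
theorem generic_points_open_dense (k ℓ d n m : ℕ) (hparam : ℓ < d * k)
    (ends : Fin m → Finset (Fin n)) (hunif : ∀ e, (ends e).card = d)
    (hsparse : ∀ V' : Finset (Fin n),
      (Finset.univ.filter fun e => ends e ⊆ V').card ≤ k * V'.card - ℓ) :
    (∃ P : MvPolynomial (GenVars n k ends) ℝ, P ≠ 0 ∧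
        ∀ v : GenVars n k ends → ℝ, MvPolynomial.eval v P ≠ 0 →
          (realization n k ends v).rank = m) ∧
      IsOpen {v : GenVars n k ends → ℝ | (realization n k ends v).rank = m} ∧
      Dense {v : GenVars n k ends → ℝ | (realization n k ends v).rank = m} := by
  obtain ⟨f, hf, hmem⟩ := exists_injective_endpoint_column n k ends
    fun V' => (hsparse V').trans (Nat.sub_le _ _)
  have hP := det_genericNaturalMatrix_submatrix_ne_zero n k ends hf hmem
  have hrank : ∀ v : GenVars n k ends → ℝ,
      MvPolynomial.eval v ((genericNaturalMatrix n k ends).submatrix id f).det ≠ 0 →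
        (realization n k ends v).rank = m := by
    intro v hv
    rw [RingHom.map_det, RingHom.mapMatrix_apply, ← Matrix.submatrix_map,
      genericNaturalMatrix_map_eval] at hv
    refine le_antisymm ?_ ?_
    · simpa using (realization n k ends v).rank_le_card_height
    · simpa [Matrix.rank_of_det_ne_zero hv] using
        (realization n k ends v).rank_submatrix_le id f
  refine ⟨⟨_, hP, hrank⟩, ?_, (MvPolynomial.dense_setOf_eval_ne_zero hP).mono hrank⟩
  have hset : {v : GenVars n k ends → ℝ | (realization n k ends v).rank = m} =
      {v | (realization n k ends v * (realization n k ends v).transpose).det ≠ 0} := by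
    ext v
    simpa using (realization n k ends v).rank_eq_card_iff_det_mul_transpose_ne_zero
  rw [hset]
  have hcont := continuous_realization n k ends
  exact isOpen_ne_fun (hcont.matrix_mul hcont.matrix_transpose).matrix_det continuous_const
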